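/- Asymptotic decoupling under partial diffusion (intermediate step in the proof of Lemma 4.4): Let m, n ≥ 1 and let M_AB be a valid quantum covariance matrix of size 2(m+n) with diagonal blocks M_A and M_B. Then lim_{t→∞} ( E(M_AB + t·(I_A⊕0_B)) − E(M_A + t·I_{2m}) − E(M_B) ) = 0. -/

import Mathlib

open scoped Classical ComplexOrder

noncomputable section

/-- The function `g(x) = (x+1)·log(x+1) − x·log x` (with `g 0 = 0` since `log 0 = 0`). -/
def gFn (x : ℝ) : ℝ := (x + 1) * Real.log (x + 1) - x * Real.log x

/-- Single-mode entropy as a function of the symplectic eigenvalue: `G(λ) = g((λ−1)/2)`. -/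
def GFn (lam : ℝ) : ℝ := gFn ((lam - 1) / 2)

/-- Inverse temperature `β(λ) = log((λ+1)/(λ−1))`. -/
def betaFn (lam : ℝ) : ℝ := Real.log ((lam + 1) / (lam - 1))

/-- The standard symplectic form matrix on `ℝ^d` (for even `d = 2N` this is the
block-diagonal matrix with `N` diagonal blocks `[[0,1],[-1,0]]`). -/
def Jmat (d : ℕ) : Matrix (Fin d) (Fin d) ℝ := fun i j =>
  if (i : ℕ) % 2 = 0 ∧ (j : ℕ) = (i : ℕ) + 1 then 1
  else if (j : ℕ) % 2 = 0 ∧ (i : ℕ) = (j : ℕ) + 1 then -1 else 0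

/-- A real `d×d` matrix is symplectic if `S·J·Sᵀ = J`. -/
def IsSymplectic {d : ℕ} (S : Matrix (Fin d) (Fin d) ℝ) : Prop :=
  S * Jmat d * S.transpose = Jmat d

/-- The doubled diagonal matrix `D(λ) = diag(λ₀,λ₀,λ₁,λ₁,…)`. -/
def Dmat (d : ℕ) (lam : ℕ → ℝ) : Matrix (Fin d) (Fin d) ℝ :=
  Matrix.diagonal fun i => lam ((i : ℕ) / 2)

/-- A valid quantum covariance matrix: `M` symmetric with `M + i·J ⪰ 0`. -/
def IsQCov {d : ℕ} (M : Matrix (Fin d) (Fin d) ℝ) : Prop :=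
  M.IsSymm ∧
    (M.map (Complex.ofReal) + Complex.I • (Jmat d).map Complex.ofReal).PosSemidef

/-- Entropy functional `E(M) = Σⱼ G(λⱼ)` where `λⱼ` are the symplectic eigenvalues of `M`:
the eigenvalues of `i·J·M` are `±λⱼ`, so `E(M) = (1/2)·Σ_{μ root of charpoly} G(|Re μ|)`. -/
def Ent {d : ℕ} (M : Matrix (Fin d) (Fin d) ℝ) : ℝ :=
  ((Matrix.charpoly (Complex.I • ((Jmat d * M).map Complex.ofReal))).roots.map
    fun μ => GFn |μ.re|).sum / 2

/-- The matrix `I_A ⊕ 0_B`: identity on the first `a` coordinates, zero on the rest. -/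
def IA0B (d a : ℕ) : Matrix (Fin d) (Fin d) ℝ :=
  Matrix.diagonal fun i => if (i : ℕ) < a then 1 else 0

/-- Assemble a symmetric 2×2 block matrix `[[A, K], [Kᵀ, B]]`. -/
def assemble2 {a b : ℕ} (A : Matrix (Fin a) (Fin a) ℝ) (K : Matrix (Fin a) (Fin b) ℝ)
    (B : Matrix (Fin b) (Fin b) ℝ) : Matrix (Fin (a + b)) (Fin (a + b)) ℝ := fun i j =>
  if hi : (i : ℕ) < a then
    if hj : (j : ℕ) < a then A ⟨i, hi⟩ ⟨j, hj⟩
    else K ⟨i, hi⟩ ⟨(j : ℕ) - a, by have := j.isLt; omega⟩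
  else
    if hj : (j : ℕ) < a then K ⟨j, hj⟩ ⟨(i : ℕ) - a, by have := i.isLt; omega⟩
    else B ⟨(i : ℕ) - a, by have := i.isLt; omega⟩ ⟨(j : ℕ) - a, by have := j.isLt; omega⟩

/-- Assemble the symmetric 3×3 block matrix
`[[Y, K₁, K₂], [K₁ᵀ, B₁, 0], [K₂ᵀ, 0, B₂]]`. -/
def assemble3 {a b c : ℕ} (Y : Matrix (Fin a) (Fin a) ℝ)
    (K₁ : Matrix (Fin a) (Fin b) ℝ) (K₂ : Matrix (Fin a) (Fin c) ℝ)
    (B₁ : Matrix (Fin b) (Fin b) ℝ) (B₂ : Matrix (Fin c) (Fin c) ℝ) :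
    Matrix (Fin (a + b + c)) (Fin (a + b + c)) ℝ := fun i j =>
  if hi : (i : ℕ) < a then
    if hj : (j : ℕ) < a then Y ⟨i, hi⟩ ⟨j, hj⟩
    else if hj' : (j : ℕ) < a + b then K₁ ⟨i, hi⟩ ⟨(j : ℕ) - a, by omega⟩
    else K₂ ⟨i, hi⟩ ⟨(j : ℕ) - a - b, by have := j.isLt; omega⟩
  else if hi' : (i : ℕ) < a + b then
    if hj : (j : ℕ) < a then K₁ ⟨j, hj⟩ ⟨(i : ℕ) - a, by omega⟩
    else if hj' : (j : ℕ) < a + b then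
      B₁ ⟨(i : ℕ) - a, by omega⟩ ⟨(j : ℕ) - a, by omega⟩
    else 0
  else
    if hj : (j : ℕ) < a then K₂ ⟨j, hj⟩ ⟨(i : ℕ) - a - b, by have := i.isLt; omega⟩
    else if hj' : (j : ℕ) < a + b then 0
    else B₂ ⟨(i : ℕ) - a - b, by have := i.isLt; omega⟩
      ⟨(j : ℕ) - a - b, by have := j.isLt; omega⟩

open Filter Topology

theorem Ultrafilter.exists_tendsto_nhds_or_tendsto_norm_atTop {α : Type*} (U : Ultrafilter α)
    (u : α → ℂ) :
    (∃ z, Tendsto u U (𝓝 z)) ∨ Tendsto (fun t => ‖u t‖) U atTop := by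
  by_cases h : ∃ R : ℝ, ∀ᶠ t in (U : Filter α), ‖u t‖ ≤ R
  · obtain ⟨R, hR⟩ := h
    obtain ⟨z, -, hz⟩ := (isCompact_closedBall (0 : ℂ) R).ultrafilter_le_nhds (U.map u)
      (tendsto_principal.2 (hR.mono fun t ht => by simpa using ht))
    exact Or.inl ⟨z, hz⟩
  · push Not at h
    refine Or.inr (tendsto_atTop.2 fun R => ?_)
    filter_upwards [h R] with t ht using ht.le

/-- If split monic polynomials of fixed degree converge pointwise along an ultrafilter, then so do
their roots. -/
theorem exists_tendsto_roots {α ι : Type*} [Fintype ι] (U : Ultrafilter α) (r : α → ι → ℂ)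
    (P : Polynomial ℂ)
    (h : ∀ z, Tendsto (fun t => ∏ i, (z - r t i)) U (𝓝 (P.eval z))) :
    ∃ ρ : ι → ℂ, (∀ i, Tendsto (fun t => r t i) U (𝓝 (ρ i))) ∧
      P = ∏ i, (Polynomial.X - Polynomial.C (ρ i)) := by
  have hconv : ∀ i, ∃ z, Tendsto (fun t => r t i) U (𝓝 z) := by
    by_contra hcon
    push Not at hcon
    obtain ⟨i₀, hi₀⟩ := hcon
    let T : Finset ι := Finset.univ.filter fun i => ∃ z, Tendsto (fun t => r t i) U (𝓝 z)
    have hT : ∀ i ∈ T, ∃ z, Tendsto (fun t => r t i) U (𝓝 z) := fun i hi => by simpa [T] using hi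
    choose! l hl using hT
    obtain ⟨z, hz⟩ := Infinite.exists_notMem_finset (T.image l)
    have h1 : Tendsto (fun t => ∏ i ∈ T, (z - r t i)) U (𝓝 (∏ i ∈ T, (z - l i))) :=
      tendsto_finsetProd _ fun i hi => tendsto_const_nhds.sub (hl i hi)
    have h1n : ∏ i ∈ T, (z - l i) ≠ 0 := Finset.prod_ne_zero_iff.2 fun i hi h0 =>
      hz (Finset.mem_image.2 ⟨i, hi, (sub_eq_zero.1 h0).symm⟩)
    have h2 : Tendsto (fun t => ∏ i ∈ Tᶜ, (z - r t i)) U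
        (𝓝 (P.eval z / ∏ i ∈ T, (z - l i))) := by
      refine ((h z).div h1 h1n).congr' ?_
      filter_upwards [h1.eventually_ne h1n] with t ht
      rw [Pi.div_apply, ← Finset.prod_mul_prod_compl T, mul_div_cancel_left₀ _ ht]
    have h3 : ∀ i ∈ Tᶜ, Tendsto (fun t => ‖z - r t i‖) U atTop := fun i hi => by
      have hi' : ¬ ∃ z, Tendsto (fun t => r t i) U (𝓝 z) := by simpa [T] using hi
      have := (U.exists_tendsto_nhds_or_tendsto_norm_atTop _).resolve_left hi'
      refine tendsto_atTop_mono (fun t => ?_) (tendsto_atTop_add_const_right _ (-‖z‖) this)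
      have := norm_sub_norm_le (r t i) z
      rw [norm_sub_rev] at this
      linarith
    have h4 : ∀ V : Finset ι, V.Nonempty → (∀ i ∈ V, Tendsto (fun t => ‖z - r t i‖) U atTop) →
        Tendsto (fun t => ∏ i ∈ V, ‖z - r t i‖) U atTop := by
      intro V hV
      induction hV using Finset.Nonempty.cons_induction with
      | singleton a => intro hV; simpa using hV
      | cons a s ha hs ih =>
        intro hV
        simp only [Finset.prod_cons]
        exact (hV a (by simp)).atTop_mul_atTop₀ (ih fun i hi => hV i (by simp [hi]))
    have h5 := h4 Tᶜ ⟨i₀, by simpa [T] using hi₀⟩ h3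
    have h6 := h2.norm
    simp only [norm_prod] at h6
    exact not_tendsto_nhds_of_tendsto_atTop h5 _ h6
  choose ρ hρ using hconv
  refine ⟨ρ, hρ, Polynomial.funext fun z => ?_⟩
  rw [Polynomial.eval_prod]
  simp only [Polynomial.eval_sub, Polynomial.eval_X, Polynomial.eval_C]
  exact tendsto_nhds_unique (h z)
    (tendsto_finsetProd _ fun i _ => tendsto_const_nhds.sub (hρ i))

theorem continuous_gFn : Continuous gFn := by
  have h := Real.continuous_mul_log
  exact (h.comp (continuous_id.add continuous_const)).sub h

theorem continuous_GFn : Continuous GFn :=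
  continuous_gFn.comp ((continuous_id.sub continuous_const).div_const 2)

theorem tendsto_GFn_sub_log {l : Filter ℝ} (hl : l ≤ atTop) {v : ℝ → ℝ}
    (hv : Tendsto (fun t => v t / t) l (𝓝 1)) :
    Tendsto (fun t => GFn (v t) - (Real.log (t / 2) + 1)) l (𝓝 0) := by
  have ht : Tendsto (fun t : ℝ => t) l atTop := hl
  have hvt : Tendsto v l atTop := by
    refine (hv.pos_mul_atTop one_pos ht).congr' ?_
    filter_upwards [ht.eventually_ne_atTop 0] with t h using div_mul_cancel₀ _ h
  have hlog : Tendsto (fun t => Real.log (v t / t)) l (𝓝 0) := by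
    simpa using hv.log one_ne_zero
  have h1 := (Real.tendsto_mul_log_one_add_div_atTop 1).comp hvt
  have h2 := (Real.tendsto_mul_log_one_add_div_atTop (-1)).comp hvt
  have h3 (c : ℝ) : Tendsto (fun t => Real.log (1 + c / v t)) l (𝓝 0) := by
    have : Tendsto (fun t => 1 + c / v t) l (𝓝 (1 + 0)) :=
      tendsto_const_nhds.add (tendsto_const_nhds.div_atTop hvt)
    simpa using this.log (by simp)
  have := hlog.add ((((h1.add (h3 1)).sub (h2.sub (h3 (-1)))).div_const 2).sub_const 1)
  refine (this.congr' ?_).trans_eq ?_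
  · filter_upwards [ht.eventually_gt_atTop 0, hvt.eventually_gt_atTop 1] with t ht hv
    have e1 : 1 + 1 / v t = (v t + 1) / v t := by field_simp
    have e2 : 1 + -1 / v t = (v t - 1) / v t := by field_simp; ring
    simp only [Function.comp, e1, e2, GFn, gFn]
    rw [show (v t - 1) / 2 + 1 = (v t + 1) / 2 by ring, Real.log_div, Real.log_div, Real.log_div,
      Real.log_div, Real.log_div, Real.log_div]
    · ring
    all_goals linarith
  · norm_num

/-- Powers of `X` can be cancelled from both sides when the cofactors do not vanish at `0`. -/
theorem X_pow_mul_inj {R : Type*} [CommRing R] [IsDomain R] {a b : ℕ} {p q : Polynomial R}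
    (hp : p.eval 0 ≠ 0) (hq : q.eval 0 ≠ 0)
    (h : Polynomial.X ^ a * p = Polynomial.X ^ b * q) : p = q := by
  wlog hab : a ≤ b generalizing a b p q
  · exact (this hq hp h.symm (by omega)).symm
  obtain ⟨c, rfl⟩ := Nat.exists_eq_add_of_le hab
  rw [pow_add, mul_assoc] at h
  have h := mul_left_cancel₀ (pow_ne_zero _ Polynomial.X_ne_zero) h
  rcases c with _ | c
  · simpa using h
  · simp [h] at hp

theorem Multiset.exists_eq_map_univ {α : Type*} {N : ℕ} (s : Multiset α) (hs : s.card = N) :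
    ∃ r : Fin N → α, s = Finset.univ.val.map r := by
  subst hs
  refine ⟨fun i => s.toList.get (i.cast (by simp)), ?_⟩
  conv_lhs => rw [← s.coe_toList]
  rw [Fin.univ_val_map]
  congr 1
  refine List.ext_get (by simp) fun n h1 h2 => by simp

section BlockDeterminants

variable {p q : Type*} [Fintype p] [DecidableEq p] [Fintype q] [DecidableEq q]

theorem charpoly_fromBlocks_eval (X : Matrix p p ℂ) (Y : Matrix p q ℂ) (Z : Matrix q p ℂ)
    (W : Matrix q q ℂ) (z : ℂ) :
    (Matrix.fromBlocks X Y Z W).charpoly.eval z =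
      (Matrix.fromBlocks (z • 1 - X) (-Y) (-Z) (z • 1 - W)).det := by
  rw [Matrix.eval_charpoly]
  congr 1
  rw [Matrix.scalar_apply, ← Matrix.smul_one_eq_diagonal, ← Matrix.fromBlocks_one,
    Matrix.fromBlocks_smul, sub_eq_add_neg, Matrix.fromBlocks_neg, Matrix.fromBlocks_add]
  simp [sub_eq_add_neg]

theorem tendsto_inv_ofReal {l : Filter ℝ} (hl : l ≤ atTop) :
    Tendsto (fun t : ℝ => (t : ℂ)⁻¹) l (𝓝 0) := by
  have := (Complex.continuous_ofReal.tendsto 0).comp (tendsto_inv_atTop_zero.mono_left hl)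
  simpa [Function.comp_def] using this

/-- At scale `t` the characteristic polynomial of `[[X + t P, Y], [Z, W]]` becomes
`charpoly P * X ^ card q`. -/
theorem tendsto_charpoly_eval_mul {l : Filter ℝ} (hl : l ≤ atTop) (P X : Matrix p p ℂ)
    (Y : Matrix p q ℂ) (Z : Matrix q p ℂ) (W : Matrix q q ℂ) (w : ℂ) :
    Tendsto (fun t : ℝ => (Matrix.fromBlocks (X + (t : ℂ) • P) Y Z W).charpoly.eval (t * w) /
      (t : ℂ) ^ (Fintype.card p + Fintype.card q)) l
      (𝓝 ((P.charpoly * Polynomial.X ^ Fintype.card q).eval w)) := by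
  let D : ℂ → ℂ := fun ε => (Matrix.fromBlocks (w • 1 - ε • X - P) (-(ε • Y)) (-(ε • Z))
    (w • 1 - ε • W)).det
  have hD : Continuous D :=
    Continuous.matrix_det <| Continuous.matrix_fromBlocks (by fun_prop) (by fun_prop)
      (by fun_prop) (by fun_prop)
  have h := (hD.tendsto 0).comp (tendsto_inv_ofReal hl)
  refine (h.congr' ?_).trans_eq ?_
  · filter_upwards [hl (eventually_ne_atTop 0)] with t ht
    have ht : (t : ℂ) ≠ 0 := by exact_mod_cast ht
    rw [charpoly_fromBlocks_eval, eq_div_iff (pow_ne_zero _ ht), mul_comm, ← Fintype.card_sum]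
    simp only [Function.comp, D]
    rw [← Matrix.det_smul, Matrix.fromBlocks_smul]
    congr 2 <;> simp only [smul_sub, smul_neg, smul_smul, mul_inv_cancel₀ ht, one_smul]
    abel
  · congr 1
    simp only [D, zero_smul, sub_zero, neg_zero, Matrix.det_fromBlocks_zero₁₂]
    rw [Polynomial.eval_mul, Matrix.eval_charpoly, Matrix.scalar_apply,
      ← Matrix.smul_one_eq_diagonal]
    simp

/-- At unit scale the characteristic polynomial of `[[X + t P, Y], [Z, W]]` becomes
`det (-P) * charpoly W`. -/
theorem tendsto_charpoly_eval {l : Filter ℝ} (hl : l ≤ atTop) (P X : Matrix p p ℂ)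
    (Y : Matrix p q ℂ) (Z : Matrix q p ℂ) (W : Matrix q q ℂ) (z : ℂ) :
    Tendsto (fun t : ℝ => (Matrix.fromBlocks (X + (t : ℂ) • P) Y Z W).charpoly.eval z /
      (t : ℂ) ^ Fintype.card p) l
      (𝓝 (P.charpoly.eval 0 * W.charpoly.eval z)) := by
  let D : ℂ → ℂ := fun ε => (Matrix.fromBlocks (ε • (z • 1 - X) - P) (-(ε • Y)) (-Z)
    (z • 1 - W)).det
  have hD : Continuous D :=
    Continuous.matrix_det <| Continuous.matrix_fromBlocks (by fun_prop) (by fun_prop)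
      (by fun_prop) (by fun_prop)
  have h := (hD.tendsto 0).comp (tendsto_inv_ofReal hl)
  refine (h.congr' ?_).trans_eq ?_
  · filter_upwards [hl (eventually_ne_atTop 0)] with t ht
    have ht : (t : ℂ) ≠ 0 := by exact_mod_cast ht
    rw [charpoly_fromBlocks_eval, eq_div_iff (pow_ne_zero _ ht), mul_comm]
    simp only [Function.comp, D]
    have hs : ((t : ℂ) ^ Fintype.card p) =
        (Matrix.fromBlocks ((t : ℂ) • (1 : Matrix p p ℂ)) 0 0 (1 : Matrix q q ℂ)).det := by
      simp
    rw [hs, ← Matrix.det_mul, Matrix.fromBlocks_multiply]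
    simp only [Matrix.smul_mul, Matrix.one_mul, Matrix.zero_mul, add_zero, zero_add, smul_sub,
      smul_neg, smul_smul, mul_inv_cancel₀ ht, one_smul, mul_inv_cancel_left₀ ht, sub_sub,
      smul_add]
  · congr 1
    simp only [D, zero_smul, zero_sub, neg_zero, Matrix.det_fromBlocks_zero₁₂]
    simp [Matrix.eval_charpoly, ← Matrix.smul_one_eq_diagonal]

end BlockDeterminants

theorem sq_eq_one_of_charpoly_eval_eq_zero {p : Type*} [Fintype p] [DecidableEq p]
    {P : Matrix p p ℂ} (hP : P * P = 1) {s : ℂ} (hs : P.charpoly.eval s = 0) : s ^ 2 = 1 := by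
  have h : (s • 1 - P) * (s • 1 + P) = (s ^ 2 - 1) • (1 : Matrix p p ℂ) := by
    rw [sub_mul, mul_add, mul_add, hP]
    simp only [smul_mul_assoc, mul_smul_comm, one_mul, mul_one, sub_smul, smul_smul, sq, one_smul]
    abel
  have h' := congrArg Matrix.det h
  rw [Matrix.eval_charpoly, Matrix.scalar_apply, ← Matrix.smul_one_eq_diagonal] at hs
  rw [Matrix.det_mul, hs, zero_mul, Matrix.det_smul, Matrix.det_one, mul_one] at h'
  exact sub_eq_zero.1 (eq_zero_of_pow_eq_zero h'.symm)

/-- If, along an ultrafilter at infinity, the roots `r t i` at scale `t` tend to the roots of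
`P * X ^ b` with `P` having only roots `±1`, and at unit scale they tend to the roots of `Q`, then
their total entropy is asymptotically `natDegree P * (log (t / 2) + 1)` plus the entropy of the
roots of `Q`. -/
theorem tendsto_sum_GFn_sub_log {ι : Type*} [Fintype ι] {U : Ultrafilter ℝ}
    (hU : (U : Filter ℝ) ≤ atTop) (r : ℝ → ι → ℂ) {P Q : Polynomial ℂ} {b : ℕ}
    (hP : ∀ s, P.eval s = 0 → s ^ 2 = 1)
    (hlarge : ∀ w, Tendsto (fun t : ℝ => ∏ i, (w - r t i / t)) U
      (𝓝 ((P * Polynomial.X ^ b).eval w)))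
    (hsmall : ∀ z, Tendsto (fun t : ℝ => (∏ i, (z - r t i)) / (t : ℂ) ^ P.natDegree) U
      (𝓝 (P.eval 0 * Q.eval z))) :
    Tendsto (fun t : ℝ => ∑ i, GFn |(r t i).re| - P.natDegree * (Real.log (t / 2) + 1)) U
      (𝓝 (Q.roots.map fun μ => GFn |μ.re|).sum) := by
  have ht0 : ∀ᶠ t : ℝ in U, (t : ℂ) ≠ 0 := by
    filter_upwards [hU (eventually_ne_atTop 0)] with t ht
    exact_mod_cast ht
  obtain ⟨s, hs, hsP⟩ := exists_tendsto_roots U (fun t i => r t i / t) _ hlarge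
  have hP0 : P.eval 0 ≠ 0 := fun h => by simpa using hP 0 h
  let S : Finset ι := Finset.univ.filter fun i => s i ≠ 0
  have hSP : P = ∏ i ∈ S, (Polynomial.X - Polynomial.C (s i)) := by
    refine X_pow_mul_inj (a := b) (b := Sᶜ.card) hP0 ?_ ?_
    · rw [Polynomial.eval_prod, Finset.prod_ne_zero_iff]
      intro i hi
      simpa [S] using hi
    · rw [mul_comm, hsP, ← Finset.prod_compl_mul_prod S]
      congr 1
      rw [← Finset.prod_const]
      refine Finset.prod_congr rfl fun i hi => ?_
      have : s i = 0 := by simpa [S] using hi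
      simp [this]
  have hScard : P.natDegree = S.card := by
    conv_lhs => rw [hSP]
    rw [Polynomial.natDegree_prod_of_monic _ _ fun i _ => Polynomial.monic_X_sub_C _]
    simp
  have hGS : ∀ i ∈ S, Tendsto (fun t => GFn |(r t i).re| - (Real.log (t / 2) + 1)) U (𝓝 0) := by
    intro i hi
    refine tendsto_GFn_sub_log hU ?_
    have hsi : s i ^ 2 = 1 := by
      refine hP _ ?_
      rw [hSP, Polynomial.eval_prod]
      exact Finset.prod_eq_zero hi (by simp)
    have hre : |(s i).re| = 1 := by
      rcases sq_eq_sq_iff_eq_or_eq_neg.1 (hsi.trans (one_pow 2).symm) with h | h <;> simp [h]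
    have h := ((Complex.continuous_re.tendsto _).comp (hs i)).abs
    rw [hre] at h
    refine h.congr' ?_
    filter_upwards [hU (eventually_gt_atTop 0)] with t ht
    simp [Complex.div_ofReal_re, abs_div, abs_of_pos ht]
  have hprod (z : ℂ) : Tendsto (fun t : ℝ => ∏ i ∈ S, (z / t - r t i / t)) U
      (𝓝 (P.eval 0)) := by
    have : P.eval 0 = ∏ i ∈ S, (z * 0 - s i) := by
      conv_lhs => rw [hSP]
      simp [Polynomial.eval_prod]
    rw [this]
    exact tendsto_finsetProd _ fun i _ => ((tendsto_inv_ofReal hU).const_mul z).sub (hs i)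
  obtain ⟨ρ, hρ, hρQ⟩ := exists_tendsto_roots U (fun t (i : {i // i ∈ Sᶜ}) => r t i) Q fun z => by
    have h := (hsmall z).div (hprod z) hP0
    rw [mul_div_cancel_left₀ _ hP0] at h
    refine h.congr' ?_
    filter_upwards [ht0, (hprod z).eventually_ne hP0] with t ht hne
    rw [Pi.div_apply, div_eq_iff hne, div_eq_iff (pow_ne_zero _ ht), hScard,
      ← Finset.prod_const, Finset.prod_coe_sort Sᶜ fun i => z - r t i, mul_assoc,
      ← Finset.prod_mul_distrib, ← Finset.prod_compl_mul_prod S]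
    congr 1
    exact Finset.prod_congr rfl fun i _ => by field_simp
  have hroots : Q.roots = Finset.univ.val.map ρ := by
    rw [hρQ]
    exact Polynomial.roots_multiset_prod_X_sub_C (Finset.univ.val.map ρ) ▸ by
      rw [Multiset.map_map]; rfl
  rw [hroots, Multiset.map_map]
  have hGc : Tendsto (fun t => ∑ i : {i // i ∈ Sᶜ}, GFn |(r t i).re|) U
      (𝓝 (∑ i, GFn |(ρ i).re|)) :=
    tendsto_finsetSum _ fun i _ =>
      ((continuous_GFn.comp (continuous_abs.comp Complex.continuous_re)).tendsto _).comp (hρ i)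
  have h := (tendsto_finsetSum S hGS).add hGc
  rw [Finset.sum_const_zero, zero_add] at h
  refine h.congr fun t => ?_
  rw [Finset.sum_sub_distrib, Finset.sum_const, hScard, nsmul_eq_mul,
    Finset.sum_coe_sort Sᶜ fun i => GFn |(r t i).re|, ← Finset.sum_add_sum_compl S]
  ring

/-- The sum of `GFn |Re μ|` over the eigenvalues `μ`, which is twice the entropy. -/
def spectralEnt {p : Type*} [Fintype p] [DecidableEq p] (M : Matrix p p ℂ) : ℝ :=
  (M.charpoly.roots.map fun μ => GFn |μ.re|).sum

theorem charpoly_eval_eq_prod {p ι : Type*} [Fintype p] [DecidableEq p] [Fintype ι]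
    {M : Matrix p p ℂ} {r : ι → ℂ} (h : M.charpoly.roots = Finset.univ.val.map r) (z : ℂ) :
    M.charpoly.eval z = ∏ i, (z - r i) := by
  rw [(IsAlgClosed.splits M.charpoly).eval_eq_prod_roots_of_monic M.charpoly_monic, h,
    Multiset.map_map]
  rfl

/-- Diffusion in the first block: `card p` eigenvalues escape to infinity at rate `t`, while the
others converge to the spectrum of the second diagonal block. -/
theorem tendsto_spectralEnt_sub_log {p q : Type*} [Fintype p] [DecidableEq p] [Fintype q]
    [DecidableEq q] {P : Matrix p p ℂ} (hP : P * P = 1) (X : Matrix p p ℂ) (Y : Matrix p q ℂ)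
    (Z : Matrix q p ℂ) (W : Matrix q q ℂ) :
    Tendsto (fun t : ℝ => spectralEnt (Matrix.fromBlocks (X + (t : ℂ) • P) Y Z W) -
      Fintype.card p * (Real.log (t / 2) + 1)) atTop (𝓝 (spectralEnt W)) := by
  rw [tendsto_iff_ultrafilter]
  intro U hU
  have hcard : ∀ t : ℝ, (Matrix.fromBlocks (X + (t : ℂ) • P) Y Z W).charpoly.roots.card =
      Fintype.card p + Fintype.card q := fun t => by
    rw [← (IsAlgClosed.splits _).natDegree_eq_card_roots, Matrix.charpoly_natDegree_eq_dim,
      Fintype.card_sum]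
  choose r hr using fun t => Multiset.exists_eq_map_univ _ (hcard t)
  have h := tendsto_sum_GFn_sub_log hU r (P := P.charpoly) (Q := W.charpoly)
    (b := Fintype.card q) (fun s => sq_eq_one_of_charpoly_eval_eq_zero hP) (fun w => by
      refine (tendsto_charpoly_eval_mul hU P X Y Z W w).congr' ?_
      filter_upwards [hU (eventually_ne_atTop 0)] with t ht
      have ht : (t : ℂ) ≠ 0 := by exact_mod_cast ht
      rw [charpoly_eval_eq_prod (hr t), ← Fin.prod_const, ← Finset.prod_div_distrib]
      exact Finset.prod_congr rfl fun i _ => by field_simp)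
    (fun z => by
      refine (tendsto_charpoly_eval hU P X Y Z W z).congr fun t => ?_
      rw [charpoly_eval_eq_prod (hr t), Matrix.charpoly_natDegree_eq_dim])
  refine h.congr fun t => ?_
  rw [Matrix.charpoly_natDegree_eq_dim, spectralEnt, hr t, Multiset.map_map]
  rfl

theorem Jmat_mul_self (N : ℕ) : Jmat (2 * N) * Jmat (2 * N) = -1 := by
  let c : Fin (2 * N) → Fin (2 * N) := fun i =>
    ⟨if (i : ℕ) % 2 = 0 then i + 1 else i - 1, by have := i.isLt; split_ifs <;> omega⟩
  ext i k
  rw [Matrix.mul_apply, Finset.sum_eq_single (c i)]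
  · have := i.isLt
    simp only [Jmat, c, Matrix.neg_apply, Matrix.one_apply, Fin.ext_iff]
    split_ifs <;> first | omega | norm_num
  · intro j _ hj
    have : Jmat (2 * N) i j = 0 := by
      simp only [Jmat, c, ne_eq, Fin.ext_iff] at hj ⊢
      split_ifs at hj ⊢ <;> first | omega | rfl
    rw [this, zero_mul]
  · simp

theorem reindex_Jmat (m n : ℕ) : Matrix.reindex finSumFinEquiv.symm finSumFinEquiv.symm
    (Jmat (2 * m + 2 * n)) = Matrix.fromBlocks (Jmat (2 * m)) 0 0 (Jmat (2 * n)) := by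
  ext (i | i) (j | j) <;> have := i.isLt <;> have := j.isLt <;> simp [Jmat] <;> grind

theorem reindex_assemble2 {a b : ℕ} (A : Matrix (Fin a) (Fin a) ℝ) (K : Matrix (Fin a) (Fin b) ℝ)
    (B : Matrix (Fin b) (Fin b) ℝ) : Matrix.reindex finSumFinEquiv.symm finSumFinEquiv.symm
    (assemble2 A K B) = Matrix.fromBlocks A K K.transpose B := by
  ext (i | i) (j | j) <;> simp [assemble2]

theorem reindex_IA0B (a b : ℕ) : Matrix.reindex finSumFinEquiv.symm finSumFinEquiv.symm
    (IA0B (a + b) a) = Matrix.fromBlocks 1 0 0 0 := by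
  ext (i | i) (j | j) <;> simp [IA0B, Matrix.diagonal_apply, Matrix.one_apply, Fin.ext_iff]
  omega

theorem Ent_eq_spectralEnt {d : ℕ} (M : Matrix (Fin d) (Fin d) ℝ) :
    Ent M = spectralEnt (Complex.I • (Jmat d * M).map Complex.ofReal) / 2 := rfl

theorem spectralEnt_reindex {p q : Type*} [Fintype p] [DecidableEq p] [Fintype q] [DecidableEq q]
    (e : p ≃ q) (M : Matrix p p ℂ) : spectralEnt (Matrix.reindex e e M) = spectralEnt M := by
  rw [spectralEnt, Matrix.charpoly_reindex, spectralEnt]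

theorem spectralEnt_fromBlocks_of_isEmpty {p q : Type*} [Fintype p] [DecidableEq p] [Fintype q]
    [DecidableEq q] [IsEmpty q] (X : Matrix p p ℂ) :
    spectralEnt (Matrix.fromBlocks X 0 0 (0 : Matrix q q ℂ)) = spectralEnt X := by
  rw [spectralEnt, Matrix.charpoly_fromBlocks_zero₁₂, Matrix.charpoly_isEmpty (n := q), mul_one,
    spectralEnt]

theorem smul_Jmat_map_mul_self (N : ℕ) :
    (Complex.I • (Jmat (2 * N)).map Complex.ofReal) *
      (Complex.I • (Jmat (2 * N)).map Complex.ofReal) = 1 := by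
  have h : (Jmat (2 * N)).map Complex.ofReal * (Jmat (2 * N)).map Complex.ofReal = -1 := by
    have := congrArg (Complex.ofRealHom.mapMatrix) (Jmat_mul_self N)
    rwa [map_mul, map_neg, map_one] at this
  rw [smul_mul_smul_comm, h, Complex.I_mul_I, neg_smul_neg, one_smul]

theorem smul_Jmat_mul_map_add_smul_one {d : ℕ} (A : Matrix (Fin d) (Fin d) ℝ) (t : ℝ) :
    Complex.I • (Jmat d * (A + t • 1)).map Complex.ofReal =
      Complex.I • (Jmat d * A).map Complex.ofReal +
        (t : ℂ) • (Complex.I • (Jmat d).map Complex.ofReal) := by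
  ext i j
  simp [Matrix.mul_add]
  ring

theorem Ent_assemble2_add_smul (m n : ℕ) (A : Matrix (Fin (2 * m)) (Fin (2 * m)) ℝ)
    (K : Matrix (Fin (2 * m)) (Fin (2 * n)) ℝ) (B : Matrix (Fin (2 * n)) (Fin (2 * n)) ℝ) (t : ℝ) :
    Ent (assemble2 A K B + t • IA0B (2 * m + 2 * n) (2 * m)) =
      spectralEnt (Matrix.fromBlocks
        (Complex.I • (Jmat (2 * m) * A).map Complex.ofReal +
          (t : ℂ) • (Complex.I • (Jmat (2 * m)).map Complex.ofReal))
        (Complex.I • (Jmat (2 * m) * K).map Complex.ofReal)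
        (Complex.I • (Jmat (2 * n) * K.transpose).map Complex.ofReal)
        (Complex.I • (Jmat (2 * n) * B).map Complex.ofReal)) / 2 := by
  have h : Matrix.reindex finSumFinEquiv.symm finSumFinEquiv.symm
      (Jmat (2 * m + 2 * n) * (assemble2 A K B + t • IA0B (2 * m + 2 * n) (2 * m))) =
      Matrix.fromBlocks (Jmat (2 * m) * (A + t • 1)) (Jmat (2 * m) * K)
        (Jmat (2 * n) * K.transpose) (Jmat (2 * n) * B) := by
    rw [← Matrix.coe_reindexAlgEquiv ℝ ℝ, map_mul, map_add, map_smul]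
    simp only [Matrix.coe_reindexAlgEquiv]
    rw [reindex_Jmat, reindex_assemble2, reindex_IA0B, Matrix.fromBlocks_smul,
      Matrix.fromBlocks_add, Matrix.fromBlocks_multiply]
    simp
  rw [Ent_eq_spectralEnt, ← spectralEnt_reindex finSumFinEquiv.symm,
    ← smul_Jmat_mul_map_add_smul_one, ← Matrix.fromBlocks_smul, ← Matrix.fromBlocks_map, ← h]
  rfl

/-- Asymptotic decoupling under partial diffusion. -/
theorem asymptotic_decoupling (m n : ℕ) (hm : 1 ≤ m) (hn : 1 ≤ n)
    (A : Matrix (Fin (2 * m)) (Fin (2 * m)) ℝ) (K : Matrix (Fin (2 * m)) (Fin (2 * n)) ℝ)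
    (B : Matrix (Fin (2 * n)) (Fin (2 * n)) ℝ)
    (hQ : IsQCov (assemble2 A K B)) :
    Filter.Tendsto
      (fun t : ℝ => Ent (assemble2 A K B + t • IA0B (2 * m + 2 * n) (2 * m))
        - Ent (A + t • 1) - Ent B)
      Filter.atTop (nhds 0) := by
  have hP := smul_Jmat_map_mul_self m
  have h₁ := tendsto_spectralEnt_sub_log hP
    (Complex.I • (Jmat (2 * m) * A).map Complex.ofReal)
    (Complex.I • (Jmat (2 * m) * K).map Complex.ofReal)
    (Complex.I • (Jmat (2 * n) * K.transpose).map Complex.ofReal)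
    (Complex.I • (Jmat (2 * n) * B).map Complex.ofReal)
  have h₂ := tendsto_spectralEnt_sub_log hP
    (Complex.I • (Jmat (2 * m) * A).map Complex.ofReal) 0 0 (0 : Matrix (Fin 0) (Fin 0) ℂ)
  simp only [spectralEnt_fromBlocks_of_isEmpty] at h₂
  have h₀ : spectralEnt (0 : Matrix (Fin 0) (Fin 0) ℂ) = 0 := by
    simp [spectralEnt, Matrix.charpoly_isEmpty]
  have h := (((h₁.sub h₂).div_const 2).sub_const (Ent B))
  rw [h₀, sub_zero, ← Ent_eq_spectralEnt, sub_self] at h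
  refine h.congr fun t => ?_
  rw [Ent_assemble2_add_smul, Ent_eq_spectralEnt (A + t • 1), smul_Jmat_mul_map_add_smul_one]
  ring

end
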